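/- arXiv:2409.14641 — 4 statements merged into one kernel-verified Lean document; each statement's English description precedes it below -/
import Mathlib

section
/- Let m ≥ 2 and k ≥ 0 be integers. Assume that for every r ∈ J_κ and i ∈ J_{η_r} the sequence (μ({x^r_{i,k+j+1}}))_{j∈ℤ₊} is a polynomial in j of degree at most m−1, and that ∑_{i=1}^{η_r} ∑_{j=1}^{m+k} μ({x^r_{i,j}}) < ∞ for every r ∈ J_κ. Then the following are equivalent: (a) for every r ∈ J_κ and i ∈ J_{η_r} the sequence (μ({x^r_{i,k+j+1}}))_{j∈ℤ₊} is a polynomial in j of degree at most m−2; (b) ∑_{r=1}^{κ} μ({x_r}) ∑_{p=0}^{m} (−1)^p binom(m,p) h_{p+k}(x_r) = 0. -/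
open MeasureTheory Finset

noncomputable section

/-- A real sequence indexed by the nonnegative integers is a polynomial in `n` of degree
at most `d` if some real polynomial of degree at most `d` interpolates it. -/
def IsPolySeq (d : ℕ) (γ : ℕ → ℝ) : Prop :=
  ∃ q : Polynomial ℝ, q.natDegree ≤ d ∧ ∀ n : ℕ, q.eval (n : ℝ) = γ n

/-- The Radon–Nikodym derivative `h_p` of `μ ∘ φ^{-p}` with respect to `μ` in the discrete
setting: `h_p(x) = μ(φ^{-p}({x}))/μ({x})`. -/
def hRN {X : Type*} [MeasurableSpace X] (μ : Measure X) (φ : X → X) (p : ℕ) (x : X) : ℝ :=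
  (μ ((φ^[p]) ⁻¹' {x})).toReal / (μ {x}).toReal

/-- Sum of an `ℝ≥0∞`-valued family over the branch indices `i ∈ J_{η r}`. -/
def bsumE (η : ℕ → ℕ∞) (r : ℕ) (f : ℕ → ENNReal) : ENNReal :=
  ∑' i : ℕ, Set.indicator {i : ℕ | 1 ≤ i ∧ (i : ℕ∞) ≤ η r} f i

/-- alternating binomial sum -/
def altT (d : ℕ) (γ : ℕ → ℝ) : ℝ :=
  ∑ p ∈ Finset.range (d + 1), (-1 : ℝ) ^ p * (d.choose p : ℝ) * γ p

lemma altT_fwd {A : Type*} [CommRing A] (d : ℕ) (f : A → ℝ) :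
    altT d (fun n => f (n : A)) = (-1) ^ d * (fwdDiff (1 : A))^[d] f 0 := by
  rw [fwdDiff_iter_eq_sum_shift, altT, Finset.mul_sum]
  refine Finset.sum_congr rfl fun p hp => ?_
  have hp' : p ≤ d := by simpa [Nat.lt_succ_iff] using hp
  obtain ⟨e, rfl⟩ := Nat.exists_eq_add_of_le hp'
  have : (-1 : ℝ) ^ e * (-1) ^ e = 1 := by rw [← mul_pow]; norm_num
  simp only [nsmul_eq_mul, mul_one, zero_add, zsmul_eq_mul]
  push_cast
  rw [Nat.add_sub_cancel_left, pow_add]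
  linear_combination (-(-1) ^ p * ((p + e).choose p : ℝ) * f p) * this

lemma altT_succ (d : ℕ) (γ : ℕ → ℝ) :
    altT (d + 1) γ = - altT d (fun n => γ (n + 1) - γ n) := by
  have h1 := altT_fwd (A := ℤ) (d + 1) (fun z => γ z.toNat)
  have h2 := altT_fwd (A := ℤ) d (fwdDiff 1 (fun z : ℤ => γ z.toNat))
  rw [Function.iterate_succ_apply] at h1
  simp only [Int.toNat_natCast] at h1
  rw [h1, pow_succ, mul_neg_one, neg_mul, ← h2]
  congr 2

lemma polyseq_key (d : ℕ) (hd : 1 ≤ d) (γ : ℕ → ℝ) (h : IsPolySeq d γ) (h0 : ∀ n, 0 ≤ γ n) :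
    0 ≤ (-1) ^ d * altT d γ ∧ (IsPolySeq (d - 1) γ ↔ (-1) ^ d * altT d γ = 0) := by
  have key : ∀ q : Polynomial ℝ, (∀ n : ℕ, q.eval (n : ℝ) = γ n) →
      (-1) ^ d * altT d γ = (fwdDiff (1 : ℝ))^[d] (fun x => q.eval x) 0 := by
    intro q hq
    have := altT_fwd d (fun x => q.eval x)
    simp only [hq] at this
    change altT d γ = _ at this
    rw [this, ← mul_assoc, ← mul_pow]; norm_num
  obtain ⟨q, hq, hqe⟩ := h
  have kq := key q hqe
  rcases hq.lt_or_eq with hlt | heq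
  · have : (-1) ^ d * altT d γ = 0 := by
      rw [kq, Polynomial.fwdDiff_iter_eq_zero_of_degree_lt hlt]; rfl
    refine ⟨this.ge, fun _ => this, fun _ => ⟨q, by omega, hqe⟩⟩
  · have hv : (-1) ^ d * altT d γ = q.leadingCoeff * (d.factorial : ℝ) := by
      rw [kq, ← heq, Polynomial.fwdDiff_iter_degree_eq_factorial]; simp
    have hq0 : q ≠ 0 := by rintro rfl; simp at heq; omega
    have hdeg : 0 < q.degree := Polynomial.natDegree_pos_iff_degree_pos.1 (by omega)
    have hpos : 0 < q.leadingCoeff := by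
      by_contra hc
      have ht := (q.tendsto_atBot_of_leadingCoeff_nonpos hdeg (not_lt.1 hc)).comp
        (tendsto_natCast_atTop_atTop (R := ℝ))
      obtain ⟨n, hn⟩ := (ht.eventually (Filter.eventually_lt_atBot 0)).exists
      simp only [Function.comp, hqe] at hn
      exact absurd (h0 n) (not_le.2 hn)
    have hf : (0 : ℝ) < d.factorial := by exact_mod_cast d.factorial_pos
    have hp := mul_pos hpos hf
    refine ⟨hv ▸ hp.le, fun ⟨q', hq', hqe'⟩ => ?_, fun h => by linarith⟩
    rw [key q' hqe', Polynomial.fwdDiff_iter_eq_zero_of_degree_lt (by omega)]; rfl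

theorem stmt6
    (κ : ℕ) (hκ : 1 ≤ κ)
    (Φ₂ : ℤ → ℕ)
    (hΦ₂ : ∀ q : ℤ, (1 ≤ Φ₂ q ∧ Φ₂ q ≤ κ) ∧ (κ : ℤ) ∣ q - (Φ₂ q : ℤ))
    (X : Type*) [MeasurableSpace X] [Countable X]
    (hmeas : ∀ s : Set X, MeasurableSet s)
    (η : ℕ → ℕ∞)
    (hη : ∃ r : ℕ, 1 ≤ r ∧ r ≤ κ ∧ η r ≠ 0)
    (xc : ℕ → X) (xb : ℕ → ℕ → ℕ → X)
    (hinj₁ : ∀ r r' : ℕ, 1 ≤ r → r ≤ κ → 1 ≤ r' → r' ≤ κ → xc r = xc r' → r = r')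
    (hinj₂ : ∀ r r' i j : ℕ, 1 ≤ r → r ≤ κ → 1 ≤ r' → r' ≤ κ → 1 ≤ i → (i : ℕ∞) ≤ η r' →
      1 ≤ j → xc r ≠ xb r' i j)
    (hinj₃ : ∀ r i j r' i' j' : ℕ, 1 ≤ r → r ≤ κ → 1 ≤ i → (i : ℕ∞) ≤ η r → 1 ≤ j →
      1 ≤ r' → r' ≤ κ → 1 ≤ i' → (i' : ℕ∞) ≤ η r' → 1 ≤ j' →
      xb r i j = xb r' i' j' → r = r' ∧ i = i' ∧ j = j')
    (hsurj : ∀ x : X, (∃ r : ℕ, 1 ≤ r ∧ r ≤ κ ∧ x = xc r) ∨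
      ∃ r i j : ℕ, 1 ≤ r ∧ r ≤ κ ∧ 1 ≤ i ∧ (i : ℕ∞) ≤ η r ∧ 1 ≤ j ∧ x = xb r i j)
    (φ : X → X)
    (hφ₁ : ∀ r i j : ℕ, 1 ≤ r → r ≤ κ → 1 ≤ i → (i : ℕ∞) ≤ η r → 1 ≤ j →
      φ (xb r i (j + 1)) = xb r i j)
    (hφ₂ : ∀ r i : ℕ, 1 ≤ r → r ≤ κ → 1 ≤ i → (i : ℕ∞) ≤ η r → φ (xb r i 1) = xc r)
    (hφ₃ : ∀ r : ℕ, 1 ≤ r → r ≤ κ → φ (xc (Φ₂ ((r : ℤ) + 1))) = xc r)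
    (μ : Measure X) [SigmaFinite μ]
    (hμ : ∀ x : X, 0 < μ {x} ∧ μ {x} < ⊤)
    (m k : ℕ) (hm : 2 ≤ m)
    (hpoly : ∀ r i : ℕ, 1 ≤ r → r ≤ κ → 1 ≤ i → (i : ℕ∞) ≤ η r →
      IsPolySeq (m - 1) (fun j => (μ {xb r i (k + j + 1)}).toReal))
    (hfin : ∀ r : ℕ, 1 ≤ r → r ≤ κ →
      bsumE η r (fun i => ∑ j ∈ Finset.Icc 1 (m + k), μ {xb r i j}) < ⊤) :
    (∀ r i : ℕ, 1 ≤ r → r ≤ κ → 1 ≤ i → (i : ℕ∞) ≤ η r →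
        IsPolySeq (m - 2) (fun j => (μ {xb r i (k + j + 1)}).toReal)) ↔
      ∑ r ∈ Finset.Icc 1 κ, (μ {xc r}).toReal *
        ∑ p ∈ Finset.range (m + 1),
          (-1 : ℝ) ^ p * (m.choose p : ℝ) * hRN μ φ (p + k) (xc r) = 0 := by
  classical
  obtain ⟨d, rfl⟩ : ∃ d, m = d + 1 := ⟨m - 1, by omega⟩
  have hd : 1 ≤ d := by omega
  let C : Set X := {x | ∃ r : ℕ, 1 ≤ r ∧ r ≤ κ ∧ x = xc r}
  have hC : ∀ r : ℕ, 1 ≤ r → r ≤ κ → φ (xc r) ∈ C := by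
    intro r h1 h2
    have huniq : ∀ s : ℕ, 1 ≤ s → s ≤ κ → (κ : ℤ) ∣ (s : ℤ) + 1 - r → φ (xc r) ∈ C := by
      intro s hs1 hs2 hdv
      obtain ⟨⟨ha, hb⟩, hc⟩ := hΦ₂ ((s : ℤ) + 1)
      have hsub : (κ : ℤ) ∣ (r : ℤ) - (Φ₂ ((s : ℤ) + 1) : ℤ) := by
        have := dvd_sub hc hdv
        have e : (s : ℤ) + 1 - (Φ₂ ((s : ℤ) + 1) : ℤ) - ((s : ℤ) + 1 - r) =
            (r : ℤ) - (Φ₂ ((s : ℤ) + 1) : ℤ) := by abel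
        rwa [e] at this
      have : (r : ℤ) - (Φ₂ ((s : ℤ) + 1) : ℤ) = 0 :=
        Int.eq_zero_of_abs_lt_dvd hsub (by rw [abs_lt]; constructor <;> omega)
      have he : r = Φ₂ ((s : ℤ) + 1) := by omega
      refine ⟨s, hs1, hs2, ?_⟩
      rw [he]; exact hφ₃ s hs1 hs2
    by_cases h : r = 1
    · subst h
      exact huniq κ hκ le_rfl (by simp)
    · exact huniq (r - 1) (by omega) (by omega) (by
        have : ((r - 1 : ℕ) : ℤ) + 1 - r = 0 := by omega
        rw [this]; exact dvd_zero _)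
  have hA : ∀ (p : ℕ) (x : X), φ^[p] x ∈ C ↔ x ∈ C ∨ ∃ r i j : ℕ, 1 ≤ r ∧ r ≤ κ ∧ 1 ≤ i ∧
      (i : ℕ∞) ≤ η r ∧ 1 ≤ j ∧ j ≤ p ∧ x = xb r i j := by
    intro p
    induction p with
    | zero =>
      intro x
      simp only [Function.iterate_zero, id]
      refine ⟨Or.inl, ?_⟩
      rintro (h | ⟨r, i, j, _, _, _, _, h1, h2, _⟩)
      · exact h
      · omega
    | succ p ih =>
      intro x
      rw [Function.iterate_succ_apply, ih]
      constructor
      · intro h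
        rcases hsurj x with hx | ⟨r, i, j, h1, h2, h3, h4, h5, rfl⟩
        · exact Or.inl hx
        · right
          refine ⟨r, i, j, h1, h2, h3, h4, h5, ?_, rfl⟩
          rcases Nat.lt_or_ge 1 j with hj | hj
          · obtain ⟨j', rfl⟩ : ∃ j', j = j' + 1 := ⟨j - 1, by omega⟩
            rw [hφ₁ r i j' h1 h2 h3 h4 (by omega)] at h
            rcases h with ⟨s, hs1, hs2, hs⟩ | ⟨r', i', j'', g1, g2, g3, g4, g5, g6, g⟩
            · exact absurd hs.symm (hinj₂ s r i j' hs1 hs2 h1 h2 h3 h4 (by omega))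
            · have := hinj₃ r i j' r' i' j'' h1 h2 h3 h4 (by omega) g1 g2 g3 g4 g5 g
              omega
          · omega
      · rintro (⟨r, h1, h2, rfl⟩ | ⟨r, i, j, h1, h2, h3, h4, h5, h6, rfl⟩)
        · exact Or.inl (hC r h1 h2)
        · rcases Nat.lt_or_ge 1 j with hj | hj
          · obtain ⟨j', rfl⟩ : ∃ j', j = j' + 1 := ⟨j - 1, by omega⟩
            rw [hφ₁ r i j' h1 h2 h3 h4 (by omega)]
            exact Or.inr ⟨r, i, j', h1, h2, h3, h4, by omega, by omega, rfl⟩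
          · obtain rfl : j = 1 := by omega
            rw [hφ₂ r i h1 h2 h3 h4]
            exact Or.inl ⟨r, h1, h2, rfl⟩
  let M : ℕ → ENNReal := fun p => ∑ r ∈ Finset.Icc 1 κ, μ (φ^[p] ⁻¹' {xc r})
  have hM : ∀ p, M p = μ (φ^[p] ⁻¹' C) := by
    intro p
    have hU : φ^[p] ⁻¹' C = ⋃ r ∈ Finset.Icc 1 κ, φ^[p] ⁻¹' {xc r} := by
      ext x
      simp only [C, Set.mem_preimage, Set.mem_ofPred_eq, Set.mem_iUnion, Finset.mem_Icc,
        Set.mem_singleton_iff, exists_prop, and_assoc]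
    rw [hU, measure_biUnion_finset _ (fun _ _ => hmeas _)]
    intro r hr s hs hne
    simp only [Finset.coe_Icc, Set.mem_Icc] at hr hs
    refine Set.disjoint_left.2 fun x hx hx' => hne ?_
    simp only [Set.mem_preimage, Set.mem_singleton_iff] at hx hx'
    exact hinj₁ r s hr.1 hr.2 hs.1 hs.2 (hx.symm.trans hx')
  let L : ℕ → ℕ → ℕ → Set X := fun j r i =>
    {x | (1 ≤ i ∧ (i : ℕ∞) ≤ η r) ∧ x = xb r i j}
  have hLμ : ∀ j r i, μ (L j r i) =
      Set.indicator {i : ℕ | 1 ≤ i ∧ (i : ℕ∞) ≤ η r} (fun i => μ {xb r i j}) i := by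
    intro j r i
    by_cases h : 1 ≤ i ∧ (i : ℕ∞) ≤ η r
    · rw [Set.indicator_of_mem (by exact h)]
      congr 1
      ext x; simp [L, h]
    · rw [Set.indicator_of_notMem (by exact h)]
      have : L j r i = ∅ := by
        ext x
        simp only [L, Set.mem_ofPred_eq, Set.mem_empty_iff_false, iff_false]
        exact fun hh => h hh.1
      rw [this, measure_empty]
  have hstep : ∀ p, M (p + 1) = M p +
      ∑ r ∈ Finset.Icc 1 κ, bsumE η r (fun i => μ {xb r i (p + 1)}) := by
    intro p
    have hsplit : φ^[p + 1] ⁻¹' C = φ^[p] ⁻¹' C ∪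
        ⋃ r ∈ Finset.Icc 1 κ, ⋃ i, L (p + 1) r i := by
      ext x
      simp only [Set.mem_union, Set.mem_preimage, hA, Set.mem_iUnion, Finset.mem_Icc, L,
        Set.mem_ofPred_eq, exists_prop]
      constructor
      · rintro (h | ⟨r, i, j, h1, h2, h3, h4, h5, h6, h⟩)
        · exact Or.inl (Or.inl h)
        · rcases Nat.lt_or_ge p j with hj | hj
          · obtain rfl : j = p + 1 := by omega
            exact Or.inr ⟨r, ⟨h1, h2⟩, i, ⟨h3, h4⟩, h⟩
          · exact Or.inl (Or.inr ⟨r, i, j, h1, h2, h3, h4, h5, hj, h⟩)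
      · rintro ((h | ⟨r, i, j, h1, h2, h3, h4, h5, h6, h⟩) | ⟨r, ⟨h1, h2⟩, i, ⟨h3, h4⟩, h⟩)
        · exact Or.inl h
        · exact Or.inr ⟨r, i, j, h1, h2, h3, h4, h5, by omega, h⟩
        · exact Or.inr ⟨r, i, p + 1, h1, h2, h3, h4, by omega, le_rfl, h⟩
    rw [hM, hM, hsplit, measure_union _ (hmeas _)]
    · congr 1
      rw [measure_biUnion_finset _ (fun _ _ => hmeas _)]
      · refine Finset.sum_congr rfl fun r hr => ?_
        rw [Finset.mem_Icc] at hr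
        rw [measure_iUnion _ (fun _ => hmeas _)]
        · exact tsum_congr fun i => hLμ _ _ _
        · intro i i' hne
          refine Set.disjoint_left.2 fun x hx hx' => hne ?_
          exact (hinj₃ r i (p + 1) r i' (p + 1) hr.1 hr.2 hx.1.1 hx.1.2 (by omega) hr.1 hr.2
            hx'.1.1 hx'.1.2 (by omega) (hx.2.symm.trans hx'.2)).2.1
      · intro r hr s hs hne
        simp only [Finset.coe_Icc, Set.mem_Icc] at hr hs
        refine Set.disjoint_left.2 fun x hx hx' => hne ?_
        obtain ⟨i, hx⟩ := Set.mem_iUnion.1 hx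
        obtain ⟨i', hx'⟩ := Set.mem_iUnion.1 hx'
        exact (hinj₃ r i (p + 1) s i' (p + 1) hr.1 hr.2 hx.1.1 hx.1.2 (by omega) hs.1 hs.2
          hx'.1.1 hx'.1.2 (by omega) (hx.2.symm.trans hx'.2)).1
    · refine Set.disjoint_left.2 fun x hx hx' => ?_
      simp only [Set.mem_iUnion, Finset.mem_Icc] at hx'
      obtain ⟨r, hr, i, hi, he⟩ := hx'
      rw [Set.mem_preimage, hA] at hx
      rcases hx with ⟨s, hs1, hs2, hs⟩ | ⟨r', i', j', g1, g2, g3, g4, g5, g6, g⟩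
      · exact hinj₂ s r i (p + 1) hs1 hs2 hr.1 hr.2 hi.1 hi.2 (by omega) (hs.symm.trans he)
      · have := hinj₃ r i (p + 1) r' i' j' hr.1 hr.2 hi.1 hi.2 (by omega) g1 g2 g3 g4 g5
          (he.symm.trans g)
        omega
  have hbfin : ∀ r j : ℕ, 1 ≤ r → r ≤ κ → 1 ≤ j → j ≤ d + 1 + k →
      bsumE η r (fun i => μ {xb r i j}) ≠ ⊤ := by
    intro r j h1 h2 h3 h4
    refine ne_of_lt (lt_of_le_of_lt ?_ (hfin r h1 h2))
    refine ENNReal.tsum_le_tsum fun i => Set.indicator_le_indicator ?_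
    exact Finset.single_le_sum (f := fun j => μ {xb r i j}) (fun _ _ => zero_le)
      (Finset.mem_Icc.2 ⟨h3, h4⟩)
  have hMfin : ∀ p, p ≤ d + 1 + k → M p ≠ ⊤ := by
    intro p
    induction p with
    | zero =>
      intro _
      refine ENNReal.sum_ne_top.2 fun r _ => ?_
      simpa using (hμ (xc r)).2.ne
    | succ p ih =>
      intro hp
      rw [hstep]
      refine ENNReal.add_ne_top.2 ⟨ih (by omega), ENNReal.sum_ne_top.2 fun r hr => ?_⟩
      rw [Finset.mem_Icc] at hr
      exact hbfin r _ hr.1 hr.2 (by omega) hp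
  let c : ℕ → ℕ → ℕ → ℝ := fun r i p =>
    (Set.indicator {i : ℕ | 1 ≤ i ∧ (i : ℕ∞) ≤ η r} (fun i => μ {xb r i (k + p + 1)}) i).toReal
  have hcs : ∀ r p, 1 ≤ r → r ≤ κ → p ≤ d → Summable (fun i => c r i p) := by
    intro r p h1 h2 h3
    exact ENNReal.summable_toReal (hbfin r (k + p + 1) h1 h2 (by omega) (by omega))
  have hdiff : ∀ p, p ≤ d → (M (p + 1 + k)).toReal - (M (p + k)).toReal =
      ∑ r ∈ Finset.Icc 1 κ, ∑' i, c r i p := by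
    intro p hp
    have e : p + 1 + k = p + k + 1 := by omega
    have hb : ∀ r ∈ Finset.Icc 1 κ, bsumE η r (fun i => μ {xb r i (p + k + 1)}) ≠ ⊤ := by
      intro r hr
      rw [Finset.mem_Icc] at hr
      exact hbfin r _ hr.1 hr.2 (by omega) (by omega)
    rw [e, hstep, ENNReal.toReal_add (hMfin _ (by omega)) (ENNReal.sum_ne_top.2 hb),
      add_sub_cancel_left, ENNReal.toReal_sum hb]
    refine Finset.sum_congr rfl fun r hr => ?_
    rw [bsumE, ENNReal.tsum_toReal_eq, add_comm p k]
    exact ENNReal.ne_top_of_tsum_ne_top (hb r hr)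
  have hLHS : ∑ r ∈ Finset.Icc 1 κ, (μ {xc r}).toReal *
        ∑ p ∈ Finset.range (d + 1 + 1),
          (-1 : ℝ) ^ p * ((d + 1).choose p : ℝ) * hRN μ φ (p + k) (xc r) =
      altT (d + 1) (fun p => (M (p + k)).toReal) := by
    simp only [altT, Finset.mul_sum]
    rw [Finset.sum_comm]
    refine Finset.sum_congr rfl fun p hp => ?_
    rw [Finset.mem_range] at hp
    have hs := hMfin (p + k) (by omega)
    rw [ENNReal.toReal_sum (ENNReal.sum_ne_top.1 hs), Finset.mul_sum]
    refine Finset.sum_congr rfl fun r hr => ?_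
    have h0 : (μ {xc r}).toReal ≠ 0 := (ENNReal.toReal_pos (hμ _).1.ne' (hμ _).2.ne).ne'
    rw [hRN]
    field_simp
  have hterm : ∀ r, 1 ≤ r → r ≤ κ → Summable (fun i => (-1) ^ d * altT d (c r i)) := by
    intro r h1 h2
    refine Summable.mul_left _ (summable_sum fun p hp => Summable.mul_left _ ?_)
    exact hcs r p h1 h2 (by simpa [Nat.lt_succ_iff] using hp)
  have hsum : altT (d + 1) (fun p => (M (p + k)).toReal) =
      -((-1) ^ d * ∑ r ∈ Finset.Icc 1 κ, ∑' i, (-1) ^ d * altT d (c r i)) := by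
    rw [altT_succ]
    congr 1
    have hsq : ((-1 : ℝ) ^ d) * (-1) ^ d = 1 := by rw [← mul_pow]; norm_num
    simp only [tsum_mul_left]
    rw [← Finset.mul_sum, ← mul_assoc, hsq, one_mul]
    have e1 : ∀ r ∈ Finset.Icc 1 κ, ∑' i, altT d (c r i) =
        altT d (fun p => ∑' i, c r i p) := by
      intro r hr
      rw [Finset.mem_Icc] at hr
      simp only [altT]
      rw [Summable.tsum_finsetSum]
      · simp only [tsum_mul_left]
      · intro p hp
        exact Summable.mul_left _ (hcs r p hr.1 hr.2 (by simpa [Nat.lt_succ_iff] using hp))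
    rw [Finset.sum_congr rfl e1]
    simp only [altT]
    rw [Finset.sum_comm]
    refine Finset.sum_congr rfl fun p hp => ?_
    rw [hdiff p (by simpa [Nat.lt_succ_iff] using hp), Finset.mul_sum]
  have hcv : ∀ r i : ℕ, 1 ≤ i → (i : ℕ∞) ≤ η r →
      c r i = fun j => (μ {xb r i (k + j + 1)}).toReal := by
    intro r i h1 h2
    funext j
    simp only [c]
    rw [Set.indicator_of_mem (by exact ⟨h1, h2⟩)]
  have hcn : ∀ r i : ℕ, ¬ (1 ≤ i ∧ (i : ℕ∞) ≤ η r) → altT d (c r i) = 0 := by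
    intro r i h
    have : c r i = fun _ => 0 := by
      funext j
      simp only [c]
      rw [Set.indicator_of_notMem (by exact h)]; rfl
    rw [this]; simp [altT]
  have hkey : ∀ r i : ℕ, 1 ≤ r → r ≤ κ → 1 ≤ i → (i : ℕ∞) ≤ η r → 0 ≤ (-1) ^ d * altT d (c r i) ∧
      (IsPolySeq (d - 1) (fun j => (μ {xb r i (k + j + 1)}).toReal) ↔
        (-1) ^ d * altT d (c r i) = 0) := by
    intro r i h1 h2 h3 h4
    rw [hcv r i h3 h4]
    exact polyseq_key d hd _ (hpoly r i h1 h2 h3 h4) (fun _ => ENNReal.toReal_nonneg)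
  have hnn : ∀ r, 1 ≤ r → r ≤ κ → ∀ i, 0 ≤ (-1) ^ d * altT d (c r i) := by
    intro r h1 h2 i
    by_cases h : 1 ≤ i ∧ (i : ℕ∞) ≤ η r
    · exact (hkey r i h1 h2 h.1 h.2).1
    · rw [hcn r i h, mul_zero]
  have hpw : ((-1 : ℝ) ^ d) ≠ 0 := pow_ne_zero _ (by norm_num)
  have hd2 : d + 1 - 2 = d - 1 := by omega
  rw [hLHS, hsum, neg_eq_zero, mul_eq_zero, or_iff_right hpw, hd2,
    Finset.sum_eq_zero_iff_of_nonneg (fun r hr => tsum_nonneg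
      (hnn r (Finset.mem_Icc.1 hr).1 (Finset.mem_Icc.1 hr).2))]
  constructor
  · intro h r hr
    rw [Finset.mem_Icc] at hr
    have : ∀ i, (-1) ^ d * altT d (c r i) = 0 := by
      intro i
      by_cases hi : 1 ≤ i ∧ (i : ℕ∞) ≤ η r
      · exact (hkey r i hr.1 hr.2 hi.1 hi.2).2.1 (h r i hr.1 hr.2 hi.1 hi.2)
      · rw [hcn r i hi, mul_zero]
    simp only [this, tsum_zero]
  · intro h r i h1 h2 h3 h4
    refine (hkey r i h1 h2 h3 h4).2.2 ?_
    have hz := h r (Finset.mem_Icc.2 ⟨h1, h2⟩)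
    have hs := (hterm r h1 h2).hasSum
    rw [hz, hasSum_zero_iff_of_nonneg (hnn r h1 h2)] at hs
    exact congrFun hs i
end
end

section
/- Let m ≥ 2 and k ≥ 0 be integers and suppose κ = 1. Then the composition operator C on L²(μ) is k-quasi-m-isometric if and only if for every i ∈ J_{η_1} the sequence (μ({x^1_{i,k+j+1}}))_{j∈ℤ₊} is a polynomial in j of degree at most m−2. -/
open MeasureTheory Finset

noncomputable section

/-- `B_m(T) = ∑_{j=0}^m (-1)^j C(m,j) T*^{m-j} T^{m-j}`. -/
def BmOp {H : Type*} [NormedAddCommGroup H] [InnerProductSpace ℂ H] [CompleteSpace H]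
    (m : ℕ) (T : H →L[ℂ] H) : H →L[ℂ] H :=
  ∑ j ∈ Finset.range (m + 1), ((-1 : ℂ) ^ j * (m.choose j : ℂ)) •
    ((ContinuousLinearMap.adjoint T) ^ (m - j) * T ^ (m - j))

/-- `T` is a `k`-quasi-`m`-isometry, i.e. `T*^k B_m(T) T^k = 0`. -/
def IsQuasiIso {H : Type*} [NormedAddCommGroup H] [InnerProductSpace ℂ H] [CompleteSpace H]
    (k m : ℕ) (T : H →L[ℂ] H) : Prop :=
  (ContinuousLinearMap.adjoint T) ^ k * BmOp m T * T ^ k = 0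

lemma aux_flip (m : ℕ) (f : ℕ → ℝ) (y : ℕ) :
    ∑ j ∈ Finset.range (m + 1), ((-1 : ℝ) ^ j * (m.choose j : ℝ)) * f (y + (m - j))
      = (fwdDiff (1 : ℕ))^[m] f y := by
  rw [fwdDiff_iter_eq_sum_shift, ← Finset.sum_range_reflect]
  refine Finset.sum_congr rfl fun j hj => ?_
  have hj' : j ≤ m := by have := Finset.mem_range.1 hj; omega
  have e1 : m + 1 - 1 - j = m - j := by omega
  have e2 : m - (m - j) = j := by omega
  rw [e1, e2, Nat.choose_symm hj']
  simp

lemma aux_zero_ge (r s : ℕ) (f : ℕ → ℝ) (h : (fwdDiff (1 : ℕ))^[r] f = 0) (hs : r ≤ s) :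
    (fwdDiff (1 : ℕ))^[s] f = 0 := by
  induction s, hs using Nat.le_induction with
  | base => exact h
  | succ n _ ih =>
    rw [Function.iterate_succ_apply', ih]
    funext x
    simp [fwdDiff]

lemma aux_poly_iff (d : ℕ) (γ : ℕ → ℝ) :
    IsPolySeq d γ ↔ (fwdDiff (1 : ℕ))^[d + 1] γ = 0 := by
  constructor
  · rintro ⟨q, hq, hv⟩
    funext y
    have h := congrFun (Polynomial.fwdDiff_iter_eq_zero_of_degree_lt (P := q)
      (n := d + 1) (by omega)) (y : ℝ)
    rw [fwdDiff_iter_eq_sum_shift] at h ⊢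
    rw [Pi.zero_apply] at h ⊢
    rw [← h]
    refine Finset.sum_congr rfl fun j _ => ?_
    rw [← hv]
    simp
  · intro h
    refine ⟨∑ i ∈ Finset.range (d + 1), Polynomial.C ((fwdDiff (1 : ℕ))^[i] γ 0 / (i.factorial : ℝ))
      * descPochhammer ℝ i, ?_, ?_⟩
    · refine Polynomial.natDegree_sum_le_of_forall_le _ _ fun i hi => ?_
      refine (Polynomial.natDegree_C_mul_le _ _).trans ?_
      rw [descPochhammer_natDegree]
      have := Finset.mem_range.1 hi; omega
    · intro n
      have h1 := shift_eq_sum_fwdDiff_iter (1 : ℕ) γ n 0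
      simp only [smul_eq_mul, mul_one, zero_add, nsmul_eq_mul] at h1
      rw [h1, Polynomial.eval_finsetSum]
      have h2 : ∀ N, ∀ i ∈ Finset.range (d + 1 + N), i ∉ Finset.range (d + 1) →
          (n.choose i : ℝ) * (fwdDiff (1 : ℕ))^[i] γ 0 = 0 := by
        intro N i _ hi
        rw [aux_zero_ge _ i _ h (by simpa using hi)]
        simp
      have h3 : ∀ i ∈ Finset.range (d + 1 + (n + 1)), i ∉ Finset.range (n + 1) →
          (n.choose i : ℝ) * (fwdDiff (1 : ℕ))^[i] γ 0 = 0 := by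
        intro i _ hi
        rw [Nat.choose_eq_zero_of_lt (by simpa using hi)]
        simp
      rw [Finset.sum_subset (Finset.range_subset_range.2 (by omega)) h3,
        ← Finset.sum_subset (Finset.range_subset_range.2 (by omega)) (h2 (n + 1))]
      refine Finset.sum_congr rfl fun i _ => ?_
      rw [Nat.cast_choose_eq_descPochhammer_div ℝ]
      simp only [Polynomial.eval_mul, Polynomial.eval_C]
      ring

lemma aux_pos (r : ℕ) (γ : ℕ → ℝ) (h0 : ∀ n, 0 ≤ γ n) (N : ℕ) (ε : ℝ) (hε : 0 < ε)
    (h : ∀ n, N ≤ n → (fwdDiff (1 : ℕ))^[r] γ n ≤ -ε) : False := by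
  induction r generalizing N ε with
  | zero =>
    have := h N le_rfl
    have := h0 N
    simp only [Function.iterate_zero, id] at *
    linarith
  | succ r ih =>
    set g := (fwdDiff (1 : ℕ))^[r] γ with hg
    have hstep : ∀ n, g (N + n) ≤ g N - n * ε := by
      intro n
      induction n with
      | zero => simp
      | succ n ihn =>
        have := h (N + n) (by omega)
        rw [Function.iterate_succ_apply', ← hg, fwdDiff] at this
        push_cast
        rw [← add_assoc]
        linarith
    obtain ⟨K, hK⟩ := exists_nat_gt ((g N + 1) / ε)
    rw [div_lt_iff₀ hε] at hK
    refine ih (N + K) 1 one_pos fun n hn => ?_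
    obtain ⟨t, rfl⟩ := Nat.exists_eq_add_of_le hn
    have := hstep (K + t)
    rw [← add_assoc] at this
    push_cast at this
    have ht : 0 ≤ (t : ℝ) * ε := by positivity
    linarith

lemma aux_nonneg (r : ℕ) (γ : ℕ → ℝ) (h0 : ∀ n, 0 ≤ γ n)
    (h : (fwdDiff (1 : ℕ))^[r + 1] γ = 0) :
    0 ≤ (fwdDiff (1 : ℕ))^[r] γ 0 ∧ ∀ n, (fwdDiff (1 : ℕ))^[r] γ n = (fwdDiff (1 : ℕ))^[r] γ 0 := by
  have hc : ∀ n, (fwdDiff (1 : ℕ))^[r] γ n = (fwdDiff (1 : ℕ))^[r] γ 0 := by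
    intro n
    induction n with
    | zero => rfl
    | succ n ih =>
      have := congrFun h n
      rw [Function.iterate_succ_apply', fwdDiff, Pi.zero_apply] at this
      linarith
  refine ⟨?_, hc⟩
  by_contra hneg
  push Not at hneg
  exact aux_pos r γ h0 0 (-(fwdDiff (1 : ℕ))^[r] γ 0) (by linarith) (fun n _ => by rw [hc n]; linarith)

section op
variable {X : Type*} [MeasurableSpace X] (hmeas : ∀ s : Set X, MeasurableSet s)
  (φ : X → X) (μ : Measure X)
  (hμ : ∀ x : X, 0 < μ {x} ∧ μ {x} < ⊤)
  (C : Lp ℂ 2 μ →L[ℂ] Lp ℂ 2 μ)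
  (hC : ∀ f : Lp ℂ 2 μ, (C f : X → ℂ) =ᵐ[μ] fun x => f (φ x))

lemma aux_ae (hμ : ∀ x : X, 0 < μ {x} ∧ μ {x} < ⊤) {f g : X → ℂ} (h : f =ᵐ[μ] g) (x : X) :
    f x = g x := by
  by_contra hne
  have h0 : μ {y | ¬ f y = g y} = 0 := ae_iff.1 h
  have : μ {x} ≤ 0 := h0 ▸ measure_mono (by simpa using hne)
  exact absurd (hμ x).1 (not_lt.2 this)

include hμ hC in
lemma aux_pow (p : ℕ) (f : Lp ℂ 2 μ) (x : X) : ((C ^ p) f : Lp ℂ 2 μ) x = f (φ^[p] x) := by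
  induction p generalizing x with
  | zero => simp
  | succ p ih =>
    rw [pow_succ', mul_apply_eq_comp, aux_ae μ hμ (hC _) x, ih,
      Function.iterate_succ_apply]

include hmeas hμ hC in
lemma aux_fin (p : ℕ) (x : X) : μ (φ^[p] ⁻¹' {x}) ≠ ⊤ := by
  set e := indicatorConstLp 2 (hmeas {x}) (hμ x).2.ne (1 : ℂ) with he
  have hm := (Lp.memLp ((C ^ p) e)).meas_ge_lt_top (by simp) (by simp) (ε := 1) one_ne_zero
  refine (lt_of_le_of_lt (measure_mono ?_) hm).ne
  intro y hy
  have hy' : φ^[p] y = x := hy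
  have h1 : (e : X → ℂ) x = 1 := by
    rw [aux_ae μ hμ indicatorConstLp_coeFn x]; simp
  show (1 : NNReal) ≤ ‖((C ^ p) e : Lp ℂ 2 μ) y‖₊
  rw [aux_pow φ μ hμ C hC, hy', h1]
  simp

include hmeas hμ hC in
lemma aux_inner (p : ℕ) (x : X) (f : Lp ℂ 2 μ) :
    inner ℂ ((C ^ p) (indicatorConstLp 2 (hmeas {x}) (hμ x).2.ne (1 : ℂ))) ((C ^ p) f)
      = ((μ (φ^[p] ⁻¹' {x})).toReal : ℂ) * f x := by
  have hE : (C ^ p) (indicatorConstLp 2 (hmeas {x}) (hμ x).2.ne (1 : ℂ)) =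
      indicatorConstLp 2 (hmeas (φ^[p] ⁻¹' {x})) (aux_fin hmeas φ μ hμ C hC p x) (1 : ℂ) := by
    refine Lp.ext (Filter.Eventually.of_forall fun y => ?_)
    rw [aux_pow φ μ hμ C hC, aux_ae μ hμ indicatorConstLp_coeFn,
      aux_ae μ hμ indicatorConstLp_coeFn]
    rfl
  rw [hE, L2.inner_indicatorConstLp_one,
    setIntegral_congr_fun (g := fun _ => f x) (hmeas _) ?_]
  · simp [Measure.real]
  · intro y hy
    have hy' : φ^[p] y = x := hy
    simp only [aux_pow φ μ hμ C hC, hy']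

include hmeas hμ hC in
lemma aux_quasi (k m : ℕ) : IsQuasiIso k m C ↔ ∀ x : X,
    (fwdDiff (1 : ℕ))^[m] (fun p => (μ (φ^[p] ⁻¹' {x})).toReal) k = 0 := by
  have key : ∀ (x : X) (f : Lp ℂ 2 μ),
      inner ℂ (indicatorConstLp 2 (hmeas {x}) (hμ x).2.ne (1 : ℂ))
        (((ContinuousLinearMap.adjoint C) ^ k * BmOp m C * C ^ k) f) =
      (((fwdDiff (1 : ℕ))^[m] (fun p => (μ (φ^[p] ⁻¹' {x})).toReal) k : ℝ) : ℂ) * f x := by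
    intro x f
    have hA : ∀ (p : ℕ) (u v : Lp ℂ 2 μ), inner ℂ u (((ContinuousLinearMap.adjoint C) ^ p) v)
        = inner ℂ ((C ^ p) u) v := by
      intro p u v
      rw [← ContinuousLinearMap.star_eq_adjoint, ← star_pow, ContinuousLinearMap.star_eq_adjoint,
        ContinuousLinearMap.adjoint_inner_right]
    rw [mul_apply_eq_comp, mul_apply_eq_comp, hA, BmOp,
      ContinuousLinearMap.sum_apply, inner_sum, ← aux_flip, Complex.ofReal_sum, Finset.sum_mul]
    refine Finset.sum_congr rfl fun j _ => ?_
    rw [ContinuousLinearMap.smul_apply, inner_smul_right, mul_apply_eq_comp, hA,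
      ← mul_apply_eq_comp, ← mul_apply_eq_comp, ← pow_add,
      aux_inner hmeas φ μ hμ C hC, add_comm k]
    push_cast
    ring
  unfold IsQuasiIso
  constructor
  · intro h x
    have h1 := key x (indicatorConstLp 2 (hmeas {x}) (hμ x).2.ne (1 : ℂ))
    rw [h, aux_ae μ hμ indicatorConstLp_coeFn x] at h1
    simpa using h1.symm
  · intro h
    ext1 f
    refine Lp.ext (Filter.Eventually.of_forall fun x => ?_)
    have h1 := key x f
    rw [h x] at h1
    have h2 := aux_inner hmeas φ μ hμ C hC 0 x
      (((ContinuousLinearMap.adjoint C) ^ k * BmOp m C * C ^ k) f)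
    simp only [pow_zero, one_apply_eq_self] at h2
    rw [h1] at h2
    have h3 : (μ {x}).toReal ≠ 0 := (ENNReal.toReal_pos (hμ x).1.ne' (hμ x).2.ne).ne'
    have h4 : ((0 : Lp ℂ 2 μ) : X → ℂ) x = 0 := aux_ae μ hμ (Lp.coeFn_zero ℂ 2 μ) x
    rw [ContinuousLinearMap.zero_apply, h4]
    simpa [h3] using h2.symm
end op

theorem stmt8
    (κ : ℕ) (hκ : 1 ≤ κ)
    (Φ₂ : ℤ → ℕ)
    (hΦ₂ : ∀ q : ℤ, (1 ≤ Φ₂ q ∧ Φ₂ q ≤ κ) ∧ (κ : ℤ) ∣ q - (Φ₂ q : ℤ))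
    (X : Type*) [MeasurableSpace X] [Countable X]
    (hmeas : ∀ s : Set X, MeasurableSet s)
    (η : ℕ → ℕ∞)
    (hη : ∃ r : ℕ, 1 ≤ r ∧ r ≤ κ ∧ η r ≠ 0)
    (xc : ℕ → X) (xb : ℕ → ℕ → ℕ → X)
    (hinj₁ : ∀ r r' : ℕ, 1 ≤ r → r ≤ κ → 1 ≤ r' → r' ≤ κ → xc r = xc r' → r = r')
    (hinj₂ : ∀ r r' i j : ℕ, 1 ≤ r → r ≤ κ → 1 ≤ r' → r' ≤ κ → 1 ≤ i → (i : ℕ∞) ≤ η r' →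
      1 ≤ j → xc r ≠ xb r' i j)
    (hinj₃ : ∀ r i j r' i' j' : ℕ, 1 ≤ r → r ≤ κ → 1 ≤ i → (i : ℕ∞) ≤ η r → 1 ≤ j →
      1 ≤ r' → r' ≤ κ → 1 ≤ i' → (i' : ℕ∞) ≤ η r' → 1 ≤ j' →
      xb r i j = xb r' i' j' → r = r' ∧ i = i' ∧ j = j')
    (hsurj : ∀ x : X, (∃ r : ℕ, 1 ≤ r ∧ r ≤ κ ∧ x = xc r) ∨
      ∃ r i j : ℕ, 1 ≤ r ∧ r ≤ κ ∧ 1 ≤ i ∧ (i : ℕ∞) ≤ η r ∧ 1 ≤ j ∧ x = xb r i j)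
    (φ : X → X)
    (hφ₁ : ∀ r i j : ℕ, 1 ≤ r → r ≤ κ → 1 ≤ i → (i : ℕ∞) ≤ η r → 1 ≤ j →
      φ (xb r i (j + 1)) = xb r i j)
    (hφ₂ : ∀ r i : ℕ, 1 ≤ r → r ≤ κ → 1 ≤ i → (i : ℕ∞) ≤ η r → φ (xb r i 1) = xc r)
    (hφ₃ : ∀ r : ℕ, 1 ≤ r → r ≤ κ → φ (xc (Φ₂ ((r : ℤ) + 1))) = xc r)
    (μ : Measure X) [SigmaFinite μ]
    (hμ : ∀ x : X, 0 < μ {x} ∧ μ {x} < ⊤)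
    (C : Lp ℂ 2 μ →L[ℂ] Lp ℂ 2 μ)
    (hC : ∀ f : Lp ℂ 2 μ, (C f : X → ℂ) =ᵐ[μ] fun x => f (φ x))
    (m k : ℕ) (hm : 2 ≤ m) (hκ₁ : κ = 1) :
    IsQuasiIso k m C ↔
      ∀ i : ℕ, 1 ≤ i → (i : ℕ∞) ≤ η 1 →
        IsPolySeq (m - 2) (fun j => (μ {xb 1 i (k + j + 1)}).toReal) := by
  subst hκ₁
  have hc : φ (xc 1) = xc 1 := by
    have h := (hΦ₂ ((1 : ℕ) + 1)).1
    have h2 : Φ₂ (((1 : ℕ) : ℤ) + 1) = 1 := le_antisymm h.2 h.1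
    have := hφ₃ 1 le_rfl le_rfl
    rwa [h2] at this
  rw [aux_quasi hmeas φ μ hμ C hC]
  have hcp : ∀ p, φ^[p] (xc 1) = xc 1 := fun p => Function.iterate_fixed hc p
  -- iterates on branches
  have hbr : ∀ i : ℕ, 1 ≤ i → (i : ℕ∞) ≤ η 1 → ∀ p j, 1 ≤ j →
      φ^[p] (xb 1 i (j + p)) = xb 1 i j := by
    intro i hi hi' p
    induction p with
    | zero => intro j _; rfl
    | succ p ih =>
      intro j hj
      rw [Function.iterate_succ_apply, ← add_assoc, hφ₁ 1 i (j + p) le_rfl le_rfl hi hi' (by omega),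
        ih j hj]
  have hbc : ∀ i : ℕ, 1 ≤ i → (i : ℕ∞) ≤ η 1 → ∀ p j, 1 ≤ j → j ≤ p →
      φ^[p] (xb 1 i j) = xc 1 := by
    intro i hi hi' p j hj hjp
    obtain ⟨t, rfl⟩ := Nat.exists_eq_add_of_le hjp
    obtain ⟨j, rfl⟩ := Nat.exists_eq_add_of_le' hj
    have h1 := hbr i hi hi' j 1 le_rfl
    rw [show j + 1 + t = (t + 1) + j by omega, Function.iterate_add_apply, add_comm j 1, h1,
      Function.iterate_succ_apply, hφ₂ 1 i le_rfl le_rfl hi hi', hcp]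
  have hpre : ∀ i : ℕ, 1 ≤ i → (i : ℕ∞) ≤ η 1 → ∀ p j, 1 ≤ j →
      φ^[p] ⁻¹' {xb 1 i j} = {xb 1 i (j + p)} := by
    intro i hi hi' p j hj
    ext x
    simp only [Set.mem_preimage, Set.mem_singleton_iff]
    constructor
    · intro hx
      rcases hsurj x with ⟨r, hr, hr', rfl⟩ | ⟨r, i', j', hr, hr', h1, h2, h3, rfl⟩
      · obtain rfl : r = 1 := by omega
        rw [hcp] at hx
        exact absurd hx (hinj₂ 1 1 i j le_rfl le_rfl le_rfl le_rfl hi hi' hj)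
      · obtain rfl : r = 1 := by omega
        rcases le_or_gt j' p with hjp | hjp
        · rw [hbc i' h1 h2 p j' h3 hjp] at hx
          exact absurd hx (hinj₂ 1 1 i j le_rfl le_rfl le_rfl le_rfl hi hi' hj)
        · obtain ⟨t, rfl⟩ := Nat.exists_eq_add_of_lt hjp
          rw [show p + t + 1 = (t + 1) + p by omega, hbr i' h1 h2 p (t + 1) (by omega)] at hx
          obtain ⟨-, rfl, rfl⟩ := hinj₃ _ _ _ _ _ _ le_rfl le_rfl h1 h2 (by omega) le_rfl le_rfl
            hi hi' hj hx
          congr 1; omega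
    · rintro rfl
      exact hbr i hi hi' p j hj
  let I := {i : ℕ // 1 ≤ i ∧ (i : ℕ∞) ≤ η 1}
  have hprec : ∀ p, φ^[p + 1] ⁻¹' {xc 1} = φ^[p] ⁻¹' {xc 1} ∪ ⋃ i : I, {xb 1 i.1 (p + 1)} := by
    intro p
    ext x
    simp only [Set.mem_preimage, Set.mem_singleton_iff, Set.mem_union, Set.mem_iUnion]
    constructor
    · intro hx
      rcases hsurj x with ⟨r, hr, hr', rfl⟩ | ⟨r, i', j', hr, hr', h1, h2, h3, rfl⟩
      · obtain rfl : r = 1 := by omega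
        exact Or.inl (hcp p)
      · obtain rfl : r = 1 := by omega
        rcases lt_trichotomy j' (p + 1) with hjp | rfl | hjp
        · exact Or.inl (hbc i' h1 h2 p j' h3 (by omega))
        · exact Or.inr ⟨⟨i', h1, h2⟩, rfl⟩
        · obtain ⟨t, rfl⟩ := Nat.exists_eq_add_of_lt hjp
          rw [show p + 1 + t + 1 = (t + 1) + (p + 1) by omega,
            hbr i' h1 h2 (p + 1) (t + 1) (by omega)] at hx
          exact absurd hx.symm
            (hinj₂ 1 1 i' (t + 1) le_rfl le_rfl le_rfl le_rfl h1 h2 (by omega))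
    · rintro (hx | ⟨⟨i, h1, h2⟩, rfl⟩)
      · rw [Function.iterate_succ_apply', hx, hc]
      · exact hbc i h1 h2 _ _ (by omega) le_rfl
  have hdisj : ∀ p, Disjoint (φ^[p] ⁻¹' {xc 1}) (⋃ i : I, {xb 1 i.1 (p + 1)}) := by
    intro p
    rw [Set.disjoint_left]
    intro x hx hx'
    simp only [Set.mem_iUnion, Set.mem_singleton_iff] at hx'
    obtain ⟨⟨i, h1, h2⟩, rfl⟩ := hx'
    have hx2 : φ^[p] (xb 1 i (p + 1)) = xc 1 := hx
    rw [add_comm p 1, hbr i h1 h2 p 1 le_rfl] at hx2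
    exact hinj₂ 1 1 i 1 le_rfl le_rfl le_rfl le_rfl h1 h2 le_rfl hx2.symm
  have hMrec : ∀ p, μ (φ^[p + 1] ⁻¹' {xc 1}) =
      μ (φ^[p] ⁻¹' {xc 1}) + ∑' i : I, μ {xb 1 i.1 (p + 1)} := by
    intro p
    rw [hprec, measure_union (hdisj p) (hmeas _), measure_iUnion ?_ (fun _ => hmeas _)]
    intro i i' hne
    simp only [Function.onFun, Set.disjoint_singleton]
    intro heq
    exact hne (Subtype.ext (hinj₃ _ _ _ _ _ _ le_rfl le_rfl i.2.1 i.2.2 (by omega) le_rfl le_rfl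
      i'.2.1 i'.2.2 (by omega) heq).2.1)
  have hfin := aux_fin hmeas φ μ hμ C hC
  have hSfin : ∀ p, ∑' i : I, μ {xb 1 i.1 (p + 1)} ≠ ⊤ := by
    intro p h
    have := hMrec p
    rw [h, add_top] at this
    exact hfin _ _ this
  have hSum : ∀ p, HasSum (fun i : I => (μ {xb 1 i.1 (p + 1)}).toReal)
      (fwdDiff (1 : ℕ) (fun p => (μ (φ^[p] ⁻¹' {xc 1})).toReal) p) := by
    intro p
    have h := ENNReal.hasSum_toReal (hSfin p)
    rw [← ENNReal.tsum_toReal_eq (fun i : I => (hμ _).2.ne)] at h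
    convert h using 1
    rw [fwdDiff, hMrec, ENNReal.toReal_add (hfin _ _) (hSfin p)]
    ring
  obtain ⟨d, rfl⟩ := Nat.exists_eq_add_of_le' hm
  simp only [Nat.add_sub_cancel, aux_poly_iff]
  -- branch sums
  have hb : ∀ i : ℕ, 1 ≤ i → (i : ℕ∞) ≤ η 1 → ∀ r l,
      (fwdDiff (1 : ℕ))^[r] (fun p => (μ (φ^[p] ⁻¹' {xb 1 i (l + 1)})).toReal) k =
      (fwdDiff (1 : ℕ))^[r] (fun j => (μ {xb 1 i (k + j + 1)}).toReal) l := by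
    intro i hi hi' r l
    rw [← aux_flip, ← aux_flip]
    refine Finset.sum_congr rfl fun j _ => ?_
    rw [hpre i hi hi' _ _ (by omega)]
    congr 5
    omega
  have hcs : HasSum (fun i : I =>
      (fwdDiff (1 : ℕ))^[d + 1] (fun j => (μ {xb 1 i.1 (k + j + 1)}).toReal) 0)
      ((fwdDiff (1 : ℕ))^[d + 2] (fun p => (μ (φ^[p] ⁻¹' {xc 1})).toReal) k) := by
    rw [Function.iterate_succ_apply, ← aux_flip]
    simp only [← aux_flip (d + 1) _ 0]
    refine hasSum_sum fun j _ => ?_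
    simp only [zero_add]
    exact (hSum _).mul_left _
  constructor
  · intro h i hi hi'
    have hz : ∀ i : I, (fwdDiff (1 : ℕ))^[d + 1 + 1]
        (fun j => (μ {xb 1 i.1 (k + j + 1)}).toReal) = 0 := by
      intro i
      funext l
      rw [← hb i.1 i.2.1 i.2.2]
      exact h _
    have hn := fun i : I => aux_nonneg (d + 1) _ (fun n => ENNReal.toReal_nonneg) (hz i)
    rw [h] at hcs
    have h0 := (hasSum_zero_iff_of_nonneg (fun i : I => (hn i).1)).1 hcs
    funext l
    rw [(hn ⟨i, hi, hi'⟩).2 l]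
    exact congrFun h0 ⟨i, hi, hi'⟩
  · intro h x
    rcases hsurj x with ⟨r, hr, hr', rfl⟩ | ⟨r, i, j, hr, hr', h1, h2, h3, rfl⟩
    · obtain rfl : r = 1 := by omega
      refine hcs.unique ?_
      convert hasSum_zero with i
      rw [h i.1 i.2.1 i.2.2]; rfl
    · obtain rfl : r = 1 := by omega
      obtain ⟨l, rfl⟩ := Nat.exists_eq_add_of_le' h3
      rw [hb i h1 h2, aux_zero_ge (d + 1) (d + 2) _ (h i h1 h2) (by omega)]
      rfl
end
end

section
/- Let m ≥ 2 be an integer. Then the composition operator C on L²(μ) is m-isometric if and only if both of the following hold: (a) for every r ∈ J_κ and i ∈ J_{η_r} the sequence (μ({x^r_{i,j+1}}))_{j∈ℤ₊} is a polynomial in j of degree at most m−2; (b) ∑_{p=0}^{m} (−1)^p binom(m,p) h_p(x_r) = 0 for every r ∈ J_κ. -/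
open MeasureTheory Finset

noncomputable section

section Seq

open Filter Topology Polynomial

/-- alternating sum equals signed iterated difference -/
lemma altSum_eq (m : ℕ) (f : ℕ → ℝ) (n : ℕ) :
    ∑ k ∈ Finset.range (m + 1), (-1 : ℝ) ^ k * (m.choose k : ℝ) * f (n + k)
      = (-1) ^ m * (fwdDiff 1)^[m] f n := by
  rw [fwdDiff_iter_eq_sum_shift, Finset.mul_sum]
  refine Finset.sum_congr rfl fun k hk => ?_
  have hk' : k ≤ m := by simpa [Nat.lt_succ_iff] using hk
  have h1 : (-1 : ℝ) ^ m * (-1) ^ (m - k) = (-1) ^ k := by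
    obtain ⟨d, rfl⟩ := Nat.exists_eq_add_of_le hk'
    rw [Nat.add_sub_cancel_left, pow_add, mul_assoc, ← mul_pow]; simp
  simp only [zsmul_eq_mul, smul_eq_mul, mul_one]
  push_cast
  rw [← h1]; ring

lemma altSum_zero_iff (m : ℕ) (f : ℕ → ℝ) (n : ℕ) :
    ∑ k ∈ Finset.range (m + 1), (-1 : ℝ) ^ k * (m.choose k : ℝ) * f (n + k) = 0
      ↔ (fwdDiff 1)^[m] f n = 0 := by
  rw [altSum_eq]; simp

lemma isPolySeq_of_fwdDiff (d : ℕ) (f : ℕ → ℝ) (h : ∀ n, (fwdDiff 1)^[d + 1] f n = 0) :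
    IsPolySeq d f := by
  have hz : ∀ k, d < k → (fwdDiff 1)^[k] f 0 = 0 := by
    intro k hk
    obtain ⟨e, rfl⟩ := Nat.exists_eq_add_of_le (Nat.succ_le_of_lt hk)
    have h0 : (fwdDiff 1)^[d + 1] f = fun _ => (0:ℝ) := funext h
    rw [Nat.succ_eq_add_one, add_comm (d+1) e, Function.iterate_add_apply, h0,
      fwdDiff_iter_eq_sum_shift]
    simp
  refine ⟨∑ k ∈ Finset.range (d + 1),
    Polynomial.C ((fwdDiff 1)^[k] f 0 / (k.factorial : ℝ)) * descPochhammer ℝ k, ?_, ?_⟩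
  · refine Polynomial.natDegree_sum_le_of_forall_le _ _ fun k hk => ?_
    refine (Polynomial.natDegree_C_mul_le _ _).trans ?_
    rw [descPochhammer_natDegree]
    exact Nat.lt_succ_iff.mp (Finset.mem_range.mp hk)
  · intro n
    have hs := shift_eq_sum_fwdDiff_iter 1 f n 0
    simp only [smul_eq_mul, mul_one, zero_add] at hs
    rw [hs, Polynomial.eval_finsetSum]
    have e1 : ∀ N, n + 1 ≤ N → ∑ k ∈ Finset.range (n + 1), n.choose k • (fwdDiff 1)^[k] f 0
        = ∑ k ∈ Finset.range N, n.choose k • (fwdDiff 1)^[k] f 0 := by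
      intro N hN
      refine Finset.sum_subset (Finset.range_mono hN) fun k _ hk => ?_
      rw [Nat.choose_eq_zero_of_lt (by simpa using hk), zero_smul]
    have e2 : ∀ N, d + 1 ≤ N → ∑ k ∈ Finset.range (d + 1), n.choose k • (fwdDiff 1)^[k] f 0
        = ∑ k ∈ Finset.range N, n.choose k • (fwdDiff 1)^[k] f 0 := by
      intro N hN
      refine Finset.sum_subset (Finset.range_mono hN) fun k _ hk => ?_
      rw [hz k (by simpa using hk), smul_zero]
    rw [e1 _ (le_max_left _ (d+1)), ← e2 _ (le_max_right (n+1) _)]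
    refine Finset.sum_congr rfl fun k _ => ?_
    rw [Polynomial.eval_mul, Polynomial.eval_C, descPochhammer_eval_eq_descFactorial,
      Nat.descFactorial_eq_factorial_mul_choose, nsmul_eq_mul]
    have : (k.factorial : ℝ) ≠ 0 := by positivity
    push_cast
    field_simp

lemma fwdDiff_of_isPolySeq (d m : ℕ) (hd : d < m) (f : ℕ → ℝ) (h : IsPolySeq d f) (n : ℕ) :
    (fwdDiff 1)^[m] f n = 0 := by
  obtain ⟨q, hq, hf⟩ := h
  have h0 := congrFun (Polynomial.fwdDiff_iter_eq_zero_of_degree_lt (P := q) (n := m) (by omega)) (n : ℝ)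
  rw [fwdDiff_iter_eq_sum_shift] at h0 ⊢
  rw [← h0.trans (Pi.zero_apply _)]
  refine Finset.sum_congr rfl fun k _ => ?_
  rw [← hf]; simp

lemma fwdDiff_shift_sub (d κ : ℕ) (A : ℕ → ℝ) (h : ∀ n, (fwdDiff 1)^[d + 1] A n = 0) (n : ℕ) :
    (fwdDiff 1)^[d] (fun p => A (p + κ) - A p) n = 0 := by
  have hs : (fun p => A (p + κ) - A p) = (fun r => A (r + κ)) - A := rfl
  have h1 : (fwdDiff 1)^[d] ((fun r => A (r + κ)) - A) n
      = (fwdDiff 1)^[d] (fun r => A (r + κ)) n - (fwdDiff 1)^[d] A n := by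
    simp only [fwdDiff_iter_eq_sum_shift, ← Finset.sum_sub_distrib, Pi.sub_apply, smul_sub]
  rw [hs, h1, fwdDiff_iter_comp_add, sub_eq_zero]
  induction κ with
  | zero => rfl
  | succ k ih =>
    rw [← ih rfl]
    · have := h (n + k)
      rw [Function.iterate_succ_apply', fwdDiff, sub_eq_zero] at this
      exact this
    · simp only [fwdDiff_iter_eq_sum_shift, ← Finset.sum_sub_distrib, Pi.sub_apply, smul_sub]

lemma poly_growth (d D k : ℕ) (b g : ℕ → ℝ) (hb : IsPolySeq D b) (hg : IsPolySeq d g)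
    (hpos : ∀ n, 0 < b n) (hle : ∀ n, b (n + k) ≤ g n) : IsPolySeq d b := by
  obtain ⟨q, hq, hqb⟩ := hb
  obtain ⟨p, hp, hpg⟩ := hg
  refine ⟨q, ?_, hqb⟩
  by_contra hcon
  push Not at hcon
  set Q := q.comp (X + Polynomial.C (k : ℝ)) with hQ
  have hQd : Q.natDegree = q.natDegree := by
    rw [hQ, Polynomial.natDegree_comp, Polynomial.natDegree_X_add_C, mul_one]
  have hlt : p.degree < Q.degree := Polynomial.degree_lt_degree (by omega)
  have ht := (Polynomial.div_tendsto_atTop_zero_of_degree_lt p Q hlt).comp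
    (tendsto_natCast_atTop_atTop (R := ℝ))
  have hge : ∀ n : ℕ, 1 ≤ ((fun x => eval x p / eval x Q) ∘ (Nat.cast : ℕ → ℝ)) n := by
    intro n
    have : eval (n : ℝ) Q = b (n + k) := by
      rw [hQ, Polynomial.eval_comp, ← hqb]; simp
    simp only [Function.comp]
    rw [this, hpg, one_le_div (hpos _)]
    exact hle n
  have := ge_of_tendsto' ht hge
  norm_num at this

end Seq

section Op

lemma inner_BmOp {H : Type*} [NormedAddCommGroup H] [InnerProductSpace ℂ H] [CompleteSpace H]
    (m : ℕ) (T : H →L[ℂ] H) (g f : H) :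
    inner ℂ g (BmOp m T f) = (-1) ^ m * ∑ p ∈ Finset.range (m + 1),
      (-1 : ℂ) ^ p * (m.choose p : ℂ) * inner ℂ ((T ^ p) g) ((T ^ p) f) := by
  have hadj : ∀ p : ℕ, ∀ u v : H,
      inner ℂ u (((ContinuousLinearMap.adjoint T) ^ p) v) = inner ℂ ((T ^ p) u) v := by
    intro p
    induction p with
    | zero => intro u v; simp
    | succ p ih =>
      intro u v
      rw [pow_succ, pow_succ']
      simp only [ContinuousLinearMap.mul_apply]
      rw [ih, ContinuousLinearMap.adjoint_inner_right]
  rw [BmOp, Finset.mul_sum, ← Finset.sum_range_reflect]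
  simp only [ContinuousLinearMap.sum_apply, inner_sum]
  refine Finset.sum_congr rfl fun j hj => ?_
  have hj' : j ≤ m := by simpa [Nat.lt_succ_iff] using hj
  have h2 : m + 1 - 1 - j = m - j := by omega
  have h3 : m - (m - j) = j := by omega
  have h1 : (-1 : ℂ) ^ m * (-1) ^ j = (-1) ^ (m - j) := by
    obtain ⟨d, rfl⟩ := Nat.exists_eq_add_of_le hj'
    rw [Nat.add_sub_cancel_left, pow_add, mul_right_comm, ← mul_pow]; simp
  rw [h2, h3, Nat.choose_symm hj']
  simp only [ContinuousLinearMap.smul_apply, ContinuousLinearMap.mul_apply, inner_smul_right]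
  rw [hadj, ← h1]; ring

lemma ae_all {X : Type*} [MeasurableSpace X] [Countable X] {μ : Measure X}
    (hμ : ∀ x : X, 0 < μ {x} ∧ μ {x} < ⊤) {p : X → Prop} (h : ∀ᵐ x ∂μ, p x) (x : X) : p x :=
  (ae_iff_of_countable.mp h) x (hμ x).1.ne'

lemma pow_apply_all {X : Type*} [MeasurableSpace X] [Countable X] {μ : Measure X} {φ : X → X}
    (hμ : ∀ x : X, 0 < μ {x} ∧ μ {x} < ⊤) {C : Lp ℂ 2 μ →L[ℂ] Lp ℂ 2 μ}
    (hC : ∀ f : Lp ℂ 2 μ, (C f : X → ℂ) =ᵐ[μ] fun x => f (φ x)) (p : ℕ) (f : Lp ℂ 2 μ) (x : X) :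
    ((C ^ p) f : X → ℂ) x = f (φ^[p] x) := by
  induction p generalizing x with
  | zero => simp
  | succ p ih =>
    rw [pow_succ', ContinuousLinearMap.mul_apply, ae_all hμ (hC _) x]
    show ((C ^ p) f : X → ℂ) (φ x) = _
    rw [ih, Function.iterate_succ_apply]

lemma pre_finite {X : Type*} [MeasurableSpace X] [Countable X] {μ : Measure X} {φ : X → X}
    (hmeas : ∀ s : Set X, MeasurableSet s)
    (hμ : ∀ x : X, 0 < μ {x} ∧ μ {x} < ⊤) {C : Lp ℂ 2 μ →L[ℂ] Lp ℂ 2 μ}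
    (hC : ∀ f : Lp ℂ 2 μ, (C f : X → ℂ) =ᵐ[μ] fun x => f (φ x)) (p : ℕ) (x : X) :
    μ (φ^[p] ⁻¹' {x}) ≠ ⊤ := by
  set e : Lp ℂ 2 μ := indicatorConstLp 2 (hmeas {x}) (hμ x).2.ne (1 : ℂ) with he
  have h1 : ∀ y, (e : X → ℂ) y = Set.indicator {x} (fun _ => 1) y :=
    fun y => ae_all hμ indicatorConstLp_coeFn y
  have hm : MemLp (Set.indicator (φ^[p] ⁻¹' {x}) fun _ => (1 : ℂ)) 2 μ := by
    have : (Set.indicator (φ^[p] ⁻¹' {x}) fun _ => (1 : ℂ)) = ((C ^ p) e : X → ℂ) := by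
      funext y
      rw [pow_apply_all hμ hC, h1]
      rfl
    rw [this]
    exact Lp.memLp _
  rw [memLp_indicator_iff_restrict (hmeas _), memLp_const_iff (by simp) (by simp)] at hm
  simpa [lt_top_iff_ne_top] using hm

lemma pow_ind {X : Type*} [MeasurableSpace X] [Countable X] {μ : Measure X} {φ : X → X}
    (hmeas : ∀ s : Set X, MeasurableSet s)
    (hμ : ∀ x : X, 0 < μ {x} ∧ μ {x} < ⊤) {C : Lp ℂ 2 μ →L[ℂ] Lp ℂ 2 μ}
    (hC : ∀ f : Lp ℂ 2 μ, (C f : X → ℂ) =ᵐ[μ] fun x => f (φ x)) (p : ℕ) (x : X) :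
    (C ^ p) (indicatorConstLp 2 (hmeas {x}) (hμ x).2.ne (1 : ℂ)) =
      indicatorConstLp 2 (hmeas (φ^[p] ⁻¹' {x})) (pre_finite hmeas hμ hC p x) (1 : ℂ) := by
  apply Lp.ext
  refine Filter.Eventually.of_forall fun y => ?_
  rw [pow_apply_all hμ hC]
  rw [ae_all hμ (indicatorConstLp_coeFn (p := 2) (hs := hmeas (φ^[p] ⁻¹' {x}))
    (hμs := pre_finite hmeas hμ hC p x) (c := (1:ℂ))) y]
  rw [ae_all hμ (indicatorConstLp_coeFn (p := 2) (hs := hmeas {x})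
    (hμs := (hμ x).2.ne) (c := (1:ℂ))) _]
  rfl

lemma inner_pow_ind {X : Type*} [MeasurableSpace X] [Countable X] {μ : Measure X} {φ : X → X}
    (hmeas : ∀ s : Set X, MeasurableSet s)
    (hμ : ∀ x : X, 0 < μ {x} ∧ μ {x} < ⊤) {C : Lp ℂ 2 μ →L[ℂ] Lp ℂ 2 μ}
    (hC : ∀ f : Lp ℂ 2 μ, (C f : X → ℂ) =ᵐ[μ] fun x => f (φ x)) (p : ℕ) (x : X)
    (f : Lp ℂ 2 μ) :
    inner ℂ ((C ^ p) (indicatorConstLp 2 (hmeas {x}) (hμ x).2.ne (1 : ℂ))) ((C ^ p) f)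
      = (μ.real (φ^[p] ⁻¹' {x}) : ℂ) * f x := by
  rw [pow_ind hmeas hμ hC, L2.inner_indicatorConstLp_one]
  rw [setIntegral_congr_fun (g := fun _ => f x) (hmeas _), setIntegral_const]
  · simp
  · intro y hy
    have hy' : φ^[p] y = x := hy
    simp only [pow_apply_all hμ hC, hy']

lemma BmOp_zero_of {X : Type*} [MeasurableSpace X] [Countable X] {μ : Measure X} {φ : X → X}
    (hmeas : ∀ s : Set X, MeasurableSet s)
    (hμ : ∀ x : X, 0 < μ {x} ∧ μ {x} < ⊤) {C : Lp ℂ 2 μ →L[ℂ] Lp ℂ 2 μ}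
    (hC : ∀ f : Lp ℂ 2 μ, (C f : X → ℂ) =ᵐ[μ] fun x => f (φ x)) (m : ℕ)
    (h : ∀ x, ∑ p ∈ Finset.range (m + 1),
      (-1 : ℝ) ^ p * (m.choose p : ℝ) * μ.real (φ^[p] ⁻¹' {x}) = 0) : BmOp m C = 0 := by
  ext1 f
  apply Lp.ext
  refine (Filter.Eventually.of_forall fun x => ?_ : ∀ᵐ x ∂μ, _)
  have h1 := inner_BmOp m C (indicatorConstLp 2 (hmeas {x}) (hμ x).2.ne (1 : ℂ)) f
  simp only [inner_pow_ind hmeas hμ hC, ← mul_assoc] at h1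
  rw [← Finset.sum_mul] at h1
  have h2 : ∑ p ∈ Finset.range (m + 1),
      (-1 : ℂ) ^ p * (m.choose p : ℂ) * (μ.real (φ^[p] ⁻¹' {x}) : ℂ) = 0 := by
    have := congrArg (fun r : ℝ => (r : ℂ)) (h x)
    push_cast at this
    exact this
  rw [h2] at h1
  have h3 := inner_pow_ind hmeas hμ hC 0 x (BmOp m C f)
  simp only [pow_zero, ContinuousLinearMap.one_apply, Function.iterate_zero, Set.preimage_id] at h3
  rw [h3] at h1
  have h4 : μ.real {x} ≠ 0 := (ENNReal.toReal_pos (hμ x).1.ne' (hμ x).2.ne).ne'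
  have h5 : (BmOp m C f : X → ℂ) x = 0 := by
    simpa [h4] using h1
  rw [h5, ContinuousLinearMap.zero_apply]
  exact (ae_all hμ (Lp.coeFn_zero ℂ 2 μ) x).symm

lemma sum_of_BmOp_zero {X : Type*} [MeasurableSpace X] [Countable X] {μ : Measure X} {φ : X → X}
    (hmeas : ∀ s : Set X, MeasurableSet s)
    (hμ : ∀ x : X, 0 < μ {x} ∧ μ {x} < ⊤) {C : Lp ℂ 2 μ →L[ℂ] Lp ℂ 2 μ}
    (hC : ∀ f : Lp ℂ 2 μ, (C f : X → ℂ) =ᵐ[μ] fun x => f (φ x)) (m : ℕ)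
    (h : BmOp m C = 0) (x : X) (n : ℕ) : ∑ p ∈ Finset.range (m + 1),
      (-1 : ℝ) ^ p * (m.choose p : ℝ) * μ.real (φ^[n + p] ⁻¹' {x}) = 0 := by
  set e : Lp ℂ 2 μ := indicatorConstLp 2 (hmeas {x}) (hμ x).2.ne (1 : ℂ) with he
  have h1 := inner_BmOp m C ((C ^ n) e) ((C ^ n) e)
  rw [h, ContinuousLinearMap.zero_apply, inner_zero_right] at h1
  simp only [← ContinuousLinearMap.mul_apply, ← pow_add] at h1
  have h2 : ∀ p, inner ℂ ((C ^ (p + n)) e) ((C ^ (p + n)) e)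
      = (μ.real (φ^[n + p] ⁻¹' {x}) : ℂ) := by
    intro p
    rw [he, inner_pow_ind hmeas hμ hC, ae_all hμ (indicatorConstLp_coeFn (p := 2)
      (hs := hmeas {x}) (hμs := (hμ x).2.ne) (c := (1:ℂ))) x, add_comm]
    simp
  simp only [h2] at h1
  have h3 := (mul_eq_zero.mp h1.symm).resolve_left (by simp)
  exact_mod_cast h3

end Op

theorem stmt10
    (κ : ℕ) (hκ : 1 ≤ κ)
    (Φ₂ : ℤ → ℕ)
    (hΦ₂ : ∀ q : ℤ, (1 ≤ Φ₂ q ∧ Φ₂ q ≤ κ) ∧ (κ : ℤ) ∣ q - (Φ₂ q : ℤ))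
    (X : Type*) [MeasurableSpace X] [Countable X]
    (hmeas : ∀ s : Set X, MeasurableSet s)
    (η : ℕ → ℕ∞)
    (hη : ∃ r : ℕ, 1 ≤ r ∧ r ≤ κ ∧ η r ≠ 0)
    (xc : ℕ → X) (xb : ℕ → ℕ → ℕ → X)
    (hinj₁ : ∀ r r' : ℕ, 1 ≤ r → r ≤ κ → 1 ≤ r' → r' ≤ κ → xc r = xc r' → r = r')
    (hinj₂ : ∀ r r' i j : ℕ, 1 ≤ r → r ≤ κ → 1 ≤ r' → r' ≤ κ → 1 ≤ i → (i : ℕ∞) ≤ η r' →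
      1 ≤ j → xc r ≠ xb r' i j)
    (hinj₃ : ∀ r i j r' i' j' : ℕ, 1 ≤ r → r ≤ κ → 1 ≤ i → (i : ℕ∞) ≤ η r → 1 ≤ j →
      1 ≤ r' → r' ≤ κ → 1 ≤ i' → (i' : ℕ∞) ≤ η r' → 1 ≤ j' →
      xb r i j = xb r' i' j' → r = r' ∧ i = i' ∧ j = j')
    (hsurj : ∀ x : X, (∃ r : ℕ, 1 ≤ r ∧ r ≤ κ ∧ x = xc r) ∨
      ∃ r i j : ℕ, 1 ≤ r ∧ r ≤ κ ∧ 1 ≤ i ∧ (i : ℕ∞) ≤ η r ∧ 1 ≤ j ∧ x = xb r i j)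
    (φ : X → X)
    (hφ₁ : ∀ r i j : ℕ, 1 ≤ r → r ≤ κ → 1 ≤ i → (i : ℕ∞) ≤ η r → 1 ≤ j →
      φ (xb r i (j + 1)) = xb r i j)
    (hφ₂ : ∀ r i : ℕ, 1 ≤ r → r ≤ κ → 1 ≤ i → (i : ℕ∞) ≤ η r → φ (xb r i 1) = xc r)
    (hφ₃ : ∀ r : ℕ, 1 ≤ r → r ≤ κ → φ (xc (Φ₂ ((r : ℤ) + 1))) = xc r)
    (μ : Measure X) [SigmaFinite μ]
    (hμ : ∀ x : X, 0 < μ {x} ∧ μ {x} < ⊤)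
    (C : Lp ℂ 2 μ →L[ℂ] Lp ℂ 2 μ)
    (hC : ∀ f : Lp ℂ 2 μ, (C f : X → ℂ) =ᵐ[μ] fun x => f (φ x))
    (m : ℕ) (hm : 2 ≤ m) :
    BmOp m C = 0 ↔
      ((∀ r i : ℕ, 1 ≤ r → r ≤ κ → 1 ≤ i → (i : ℕ∞) ≤ η r →
          IsPolySeq (m - 2) (fun j => (μ {xb r i (j + 1)}).toReal)) ∧
        ∀ r : ℕ, 1 ≤ r → r ≤ κ →
          ∑ p ∈ Finset.range (m + 1),
            (-1 : ℝ) ^ p * (m.choose p : ℝ) * hRN μ φ p (xc r) = 0) := by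
  have hpos : ∀ x, 0 < μ.real {x} := fun x => ENNReal.toReal_pos (hμ x).1.ne' (hμ x).2.ne
  -- uniqueness of the residue
  have huniq : ∀ (q : ℤ) (r : ℕ), 1 ≤ r → r ≤ κ → (κ : ℤ) ∣ q - r → Φ₂ q = r := by
    intro q r h1 h2 h3
    obtain ⟨⟨h4, h5⟩, h6⟩ := hΦ₂ q
    have h7 : (κ : ℤ) ∣ (Φ₂ q : ℤ) - r := by
      have := dvd_sub h3 h6
      have e : q - (r : ℤ) - (q - (Φ₂ q : ℤ)) = (Φ₂ q : ℤ) - r := by ring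
      rwa [e] at this
    have h8 := Int.eq_zero_of_abs_lt_dvd h7 (by rw [abs_lt]; constructor <;> omega)
    omega
  have hcyc : ∀ q : ℤ, φ (xc (Φ₂ (q + 1))) = xc (Φ₂ q) := by
    intro q
    obtain ⟨⟨h4, h5⟩, h6⟩ := hΦ₂ q
    obtain ⟨⟨h4', h5'⟩, h6'⟩ := hΦ₂ (q + 1)
    rw [← hφ₃ _ h4 h5]
    congr 2
    refine (huniq _ _ h4' h5' ?_).symm
    have := dvd_sub h6' h6
    have e : q + 1 - (Φ₂ (q + 1) : ℤ) - (q - (Φ₂ q : ℤ)) = (Φ₂ q : ℤ) + 1 - Φ₂ (q + 1) := by ring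
    rwa [e] at this
  have hΦr : ∀ r : ℕ, 1 ≤ r → r ≤ κ → Φ₂ r = r := fun r h1 h2 => huniq _ _ h1 h2 (by simp)
  have hcycn : ∀ (n : ℕ) (q : ℤ), φ^[n] (xc (Φ₂ (q + n))) = xc (Φ₂ q) := by
    intro n
    induction n with
    | zero => intro q; simp
    | succ n ih =>
      intro q
      rw [Function.iterate_succ_apply]
      have e : q + ((n + 1 : ℕ) : ℤ) = (q + n) + 1 := by push_cast; ring
      rw [e, hcyc, ih]
  have hper : ∀ r : ℕ, 1 ≤ r → r ≤ κ → φ^[κ] (xc r) = xc r := by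
    intro r h1 h2
    have := hcycn κ r
    rwa [hΦr r h1 h2, huniq ((r : ℤ) + κ) r h1 h2 (by simp)] at this
  have hcirc : ∀ r : ℕ, 1 ≤ r → r ≤ κ → ∃ r', 1 ≤ r' ∧ r' ≤ κ ∧ φ (xc r) = xc r' := by
    intro r h1 h2
    have := hcyc ((r : ℤ) - 1)
    rw [sub_add_cancel, hΦr r h1 h2] at this
    exact ⟨_, (hΦ₂ _).1.1, (hΦ₂ _).1.2, this⟩
  have hpre1 : ∀ r i j : ℕ, 1 ≤ r → r ≤ κ → 1 ≤ i → (i : ℕ∞) ≤ η r → 1 ≤ j → ∀ z,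
      φ z = xb r i j ↔ z = xb r i (j + 1) := by
    intro r i j hr1 hr2 hi1 hi2 hj z
    refine ⟨fun hz => ?_, fun hz => by rw [hz]; exact hφ₁ r i j hr1 hr2 hi1 hi2 hj⟩
    rcases hsurj z with ⟨s, hs1, hs2, rfl⟩ | ⟨s, i', j', hs1, hs2, hi1', hi2', hj', rfl⟩
    · obtain ⟨r', a, b, c⟩ := hcirc s hs1 hs2
      rw [c] at hz
      exact absurd hz (hinj₂ _ _ _ _ a b hr1 hr2 hi1 hi2 hj)
    · obtain ⟨l, rfl⟩ := Nat.exists_eq_add_of_le' hj'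
      rcases Nat.eq_zero_or_pos l with rfl | hl
      · rw [zero_add, hφ₂ s i' hs1 hs2 hi1' hi2'] at hz
        exact absurd hz (hinj₂ _ _ _ _ hs1 hs2 hr1 hr2 hi1 hi2 hj)
      · rw [hφ₁ s i' l hs1 hs2 hi1' hi2' hl] at hz
        obtain ⟨rfl, rfl, rfl⟩ := hinj₃ _ _ _ _ _ _ hs1 hs2 hi1' hi2' hl hr1 hr2 hi1 hi2 hj hz
        rfl
  have hpre : ∀ r i j : ℕ, 1 ≤ r → r ≤ κ → 1 ≤ i → (i : ℕ∞) ≤ η r → 1 ≤ j → ∀ p : ℕ,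
      φ^[p] ⁻¹' {xb r i j} = {xb r i (j + p)} := by
    intro r i j hr1 hr2 hi1 hi2 hj p
    induction p with
    | zero => simp
    | succ p ih =>
      rw [Function.iterate_succ, Set.preimage_comp, ih]
      ext z
      simp only [Set.mem_preimage, Set.mem_singleton_iff]
      rw [hpre1 r i (j + p) hr1 hr2 hi1 hi2 (by omega) z, add_assoc]
  have hitb : ∀ r i : ℕ, 1 ≤ r → r ≤ κ → 1 ≤ i → (i : ℕ∞) ≤ η r → ∀ n : ℕ,
      φ^[n + 1] (xb r i (n + 1)) = xc r := by
    intro r i hr1 hr2 hi1 hi2 n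
    have : xb r i (n + 1) ∈ φ^[n] ⁻¹' {xb r i 1} := by
      rw [hpre r i 1 hr1 hr2 hi1 hi2 le_rfl, add_comm]; rfl
    rw [Function.iterate_succ_apply', show φ^[n] (xb r i (n + 1)) = xb r i 1 from this]
    exact hφ₂ r i hr1 hr2 hi1 hi2
  have hRNsum : ∀ x, (∑ p ∈ Finset.range (m + 1),
      (-1 : ℝ) ^ p * (m.choose p : ℝ) * hRN μ φ p x = 0 ↔ ∑ p ∈ Finset.range (m + 1),
      (-1 : ℝ) ^ p * (m.choose p : ℝ) * μ.real (φ^[p] ⁻¹' {x}) = 0) := by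
    intro x
    have e : ∑ p ∈ Finset.range (m + 1), (-1 : ℝ) ^ p * (m.choose p : ℝ) * hRN μ φ p x
        = (∑ p ∈ Finset.range (m + 1),
          (-1 : ℝ) ^ p * (m.choose p : ℝ) * μ.real (φ^[p] ⁻¹' {x})) / μ.real {x} := by
      rw [Finset.sum_div]
      exact Finset.sum_congr rfl fun p _ => by simp only [hRN, Measure.real, mul_div_assoc]
    rw [e, div_eq_zero_iff]
    simp [(hpos x).ne']
  constructor
  · intro hB
    have hS := sum_of_BmOp_zero hmeas hμ hC m hB
    refine ⟨?_, fun r _ _ => (hRNsum _).2 (by simpa using hS (xc r) 0)⟩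
    intro r i hr1 hr2 hi1 hi2
    obtain ⟨d, rfl⟩ := Nat.exists_eq_add_of_le' hm
    have hb : IsPolySeq (d + 1) (fun j => μ.real {xb r i (j + 1)}) := by
      refine isPolySeq_of_fwdDiff _ _ fun n => (altSum_zero_iff _ _ _).1 ?_
      have := hS (xb r i (n + 1)) 0
      simp only [zero_add, hpre r i (n + 1) hr1 hr2 hi1 hi2 (by omega)] at this
      simpa only [add_right_comm] using this
    have hA : ∀ n, (fwdDiff 1)^[d + 1 + 1] (fun p => μ.real (φ^[p] ⁻¹' {xc r})) n = 0 :=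
      fun n => (altSum_zero_iff _ _ _).1 (hS (xc r) n)
    have hD : IsPolySeq d (fun p => μ.real (φ^[p + κ] ⁻¹' {xc r}) - μ.real (φ^[p] ⁻¹' {xc r})) :=
      isPolySeq_of_fwdDiff _ _ (fwdDiff_shift_sub (d + 1) κ _ hA)
    have hgoal := poly_growth d (d + 1) (κ - 1) _ _ hb hD (fun n => hpos _) ?_
    · exact hgoal
    · intro n
      have hn : n + (κ - 1) + 1 = n + κ := by omega
      simp only [hn]
      have hsub : φ^[n] ⁻¹' {xc r} ∪ {xb r i (n + κ)} ⊆ φ^[n + κ] ⁻¹' {xc r} := by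
        rintro z (hz | hz)
        · have hz' : φ^[n] z = xc r := hz
          show φ^[n + κ] z = xc r
          rw [add_comm, Function.iterate_add_apply, hz', hper r hr1 hr2]
        · have hz' : z = xb r i (n + κ) := hz
          show φ^[n + κ] z = xc r
          rw [hz', ← hn]
          exact hitb r i hr1 hr2 hi1 hi2 _
      have hdisj : Disjoint (φ^[n] ⁻¹' {xc r}) {xb r i (n + κ)} := by
        rw [Set.disjoint_singleton_right]
        intro hz
        have h1 : φ^[n] (xb r i (n + κ)) = xc r := hz
        have h2 : xb r i (n + κ) ∈ φ^[n] ⁻¹' {xb r i κ} := by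
          rw [hpre r i κ hr1 hr2 hi1 hi2 hκ, add_comm]; rfl
        have h3 : φ^[n] (xb r i (n + κ)) = xb r i κ := h2
        exact hinj₂ r r i κ hr1 hr2 hr1 hr2 hi1 hi2 hκ (h1.symm.trans h3)
      have h1 := measureReal_mono hsub (pre_finite hmeas hμ hC (n + κ) (xc r))
      rw [measureReal_union hdisj (hmeas _) (pre_finite hmeas hμ hC n (xc r)) (hμ _).2.ne] at h1
      linarith
  · rintro ⟨ha, hb⟩
    refine BmOp_zero_of hmeas hμ hC m fun x => ?_
    rcases hsurj x with ⟨s, hs1, hs2, rfl⟩ | ⟨r, i, j, hr1, hr2, hi1, hi2, hj, rfl⟩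
    · exact (hRNsum _).1 (hb s hs1 hs2)
    · obtain ⟨l, rfl⟩ := Nat.exists_eq_add_of_le' hj
      have h1 := (altSum_zero_iff m _ l).2
        (fwdDiff_of_isPolySeq (m - 2) m (by omega) _ (ha r i hr1 hr2 hi1 hi2) l)
      simp only [hpre r i (l + 1) hr1 hr2 hi1 hi2 hj]
      simpa only [add_right_comm, Measure.real] using h1
end
end

section
/- For every p ∈ ℕ, the preimages of singletons under the p-fold iterate φ^p of the parent map are: (a) (φ^p)^{−1}({x^r_{i,j}}) = {x^r_{i,j+p}} for all r ∈ J_κ, i ∈ J_{η_r}, j ∈ ℕ; (b) (φ^p)^{−1}({x_r}) = {x_{Φ₂(p+r)}} ∪ ⋃_{j=1}^{p} ⋃_{s∈J_κ with Φ₂(p+r)=Φ₂(s+j)} ⋃_{i=1}^{η_s} {x^s_{i,j}} for all r ∈ J_κ. -/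
open MeasureTheory Finset

noncomputable section

theorem stmt18
    (κ : ℕ) (hκ : 1 ≤ κ)
    (Φ₂ : ℤ → ℕ)
    (hΦ₂ : ∀ q : ℤ, (1 ≤ Φ₂ q ∧ Φ₂ q ≤ κ) ∧ (κ : ℤ) ∣ q - (Φ₂ q : ℤ))
    (X : Type*)
    (η : ℕ → ℕ∞)
    (hη : ∃ r : ℕ, 1 ≤ r ∧ r ≤ κ ∧ η r ≠ 0)
    (xc : ℕ → X) (xb : ℕ → ℕ → ℕ → X)
    (hinj₁ : ∀ r r' : ℕ, 1 ≤ r → r ≤ κ → 1 ≤ r' → r' ≤ κ → xc r = xc r' → r = r')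
    (hinj₂ : ∀ r r' i j : ℕ, 1 ≤ r → r ≤ κ → 1 ≤ r' → r' ≤ κ → 1 ≤ i → (i : ℕ∞) ≤ η r' →
      1 ≤ j → xc r ≠ xb r' i j)
    (hinj₃ : ∀ r i j r' i' j' : ℕ, 1 ≤ r → r ≤ κ → 1 ≤ i → (i : ℕ∞) ≤ η r → 1 ≤ j →
      1 ≤ r' → r' ≤ κ → 1 ≤ i' → (i' : ℕ∞) ≤ η r' → 1 ≤ j' →
      xb r i j = xb r' i' j' → r = r' ∧ i = i' ∧ j = j')
    (hsurj : ∀ x : X, (∃ r : ℕ, 1 ≤ r ∧ r ≤ κ ∧ x = xc r) ∨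
      ∃ r i j : ℕ, 1 ≤ r ∧ r ≤ κ ∧ 1 ≤ i ∧ (i : ℕ∞) ≤ η r ∧ 1 ≤ j ∧ x = xb r i j)
    (φ : X → X)
    (hφ₁ : ∀ r i j : ℕ, 1 ≤ r → r ≤ κ → 1 ≤ i → (i : ℕ∞) ≤ η r → 1 ≤ j →
      φ (xb r i (j + 1)) = xb r i j)
    (hφ₂ : ∀ r i : ℕ, 1 ≤ r → r ≤ κ → 1 ≤ i → (i : ℕ∞) ≤ η r → φ (xb r i 1) = xc r)
    (hφ₃ : ∀ r : ℕ, 1 ≤ r → r ≤ κ → φ (xc (Φ₂ ((r : ℤ) + 1))) = xc r)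
    (p : ℕ) (hp : 1 ≤ p) :
    (∀ r i j : ℕ, 1 ≤ r → r ≤ κ → 1 ≤ i → (i : ℕ∞) ≤ η r → 1 ≤ j →
        (φ^[p]) ⁻¹' {xb r i j} = {xb r i (j + p)}) ∧
      ∀ r : ℕ, 1 ≤ r → r ≤ κ →
        (φ^[p]) ⁻¹' {xc r} =
          {xc (Φ₂ ((p + r : ℕ) : ℤ))} ∪
            ⋃ j ∈ Set.Icc 1 p,
              ⋃ s ∈ {s : ℕ | 1 ≤ s ∧ s ≤ κ ∧ Φ₂ ((p + r : ℕ) : ℤ) = Φ₂ ((s + j : ℕ) : ℤ)},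
                ⋃ i ∈ {i : ℕ | 1 ≤ i ∧ (i : ℕ∞) ≤ η s}, {xb s i j} := by
  have heq : ∀ q q' : ℤ, Φ₂ q = Φ₂ q' ↔ (κ : ℤ) ∣ q - q' := by
    intro q q'
    obtain ⟨⟨a1, a2⟩, a3⟩ := hΦ₂ q
    obtain ⟨⟨b1, b2⟩, b3⟩ := hΦ₂ q'
    constructor
    · intro h
      rw [h] at a3
      have := dvd_sub a3 b3
      rwa [sub_sub_sub_cancel_right] at this
    · intro h
      have h1 : (κ : ℤ) ∣ (Φ₂ q : ℤ) - (Φ₂ q' : ℤ) := by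
        have := dvd_add (dvd_sub h a3) b3
        have e : (Φ₂ q : ℤ) - (Φ₂ q' : ℤ) = q - q' - (q - (Φ₂ q : ℤ)) + (q' - (Φ₂ q' : ℤ)) := by ring
        rw [e]
        exact this
      have h2 := Int.eq_zero_of_abs_lt_dvd h1 (by rw [abs_lt]; constructor <;> omega)
      omega
  have hself : ∀ r : ℕ, 1 ≤ r → r ≤ κ → Φ₂ (r : ℤ) = r := by
    intro r h1 h2
    obtain ⟨⟨a1, a2⟩, a3⟩ := hΦ₂ r
    have h2 := Int.eq_zero_of_abs_lt_dvd a3 (by rw [abs_lt]; constructor <;> omega)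
    omega
  have hC1 : ∀ q : ℤ, φ (xc (Φ₂ q)) = xc (Φ₂ (q - 1)) := by
    intro q
    obtain ⟨⟨a1, a2⟩, a3⟩ := hΦ₂ (q - 1)
    rw [← hφ₃ _ a1 a2]
    congr 2
    rw [heq]
    convert a3 using 1
    ring
  have hCn : ∀ (n : ℕ) (q : ℤ), φ^[n] (xc (Φ₂ q)) = xc (Φ₂ (q - n)) := by
    intro n
    induction n with
    | zero => intro q; simp
    | succ n ih =>
      intro q
      rw [Function.iterate_succ_apply, hC1, ih]
      congr 2
      push_cast
      ring
  have hBn : ∀ (n r i j : ℕ), 1 ≤ r → r ≤ κ → 1 ≤ i → (i : ℕ∞) ≤ η r → 1 ≤ j →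
      φ^[n] (xb r i (j + n)) = xb r i j := by
    intro n r i j h1 h2 h3 h4 h5
    induction n with
    | zero => simp
    | succ n ih =>
      rw [Function.iterate_succ_apply, ← add_assoc, hφ₁ r i (j + n) h1 h2 h3 h4 (by omega), ih]
  have hBC : ∀ (n r i j : ℕ), 1 ≤ r → r ≤ κ → 1 ≤ i → (i : ℕ∞) ≤ η r → 1 ≤ j → j ≤ n →
      φ^[n] (xb r i j) = xc (Φ₂ ((r : ℤ) + j - n)) := by
    intro n r i j h1 h2 h3 h4 h5 h6
    obtain ⟨k, rfl⟩ : ∃ k, j = 1 + k := ⟨j - 1, by omega⟩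
    obtain ⟨m, rfl⟩ : ∃ m, n = m + 1 + k := ⟨n - (1 + k), by omega⟩
    rw [Function.iterate_add_apply, hBn k r i 1 h1 h2 h3 h4 le_rfl, Function.iterate_succ_apply,
      hφ₂ r i h1 h2 h3 h4]
    conv_lhs => rw [← hself r h1 h2]
    rw [hCn]
    congr 2
    push_cast
    ring
  have hCeq : ∀ q q' : ℤ, xc (Φ₂ q) = xc (Φ₂ q') ↔ Φ₂ q = Φ₂ q' := fun q q' =>
    ⟨hinj₁ _ _ (hΦ₂ q).1.1 (hΦ₂ q).1.2 (hΦ₂ q').1.1 (hΦ₂ q').1.2, fun h => by rw [h]⟩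
  constructor
  · intro r i j h1 h2 h3 h4 h5
    ext x
    simp only [Set.mem_preimage, Set.mem_singleton_iff]
    constructor
    · intro hx
      rcases hsurj x with ⟨s, s1, s2, rfl⟩ | ⟨s, i', j', s1, s2, s3, s4, s5, rfl⟩
      · rw [← hself s s1 s2, hCn] at hx
        exact absurd hx (hinj₂ _ _ _ _ (hΦ₂ _).1.1 (hΦ₂ _).1.2 h1 h2 h3 h4 h5)
      · by_cases hj : j' ≤ p
        · rw [hBC p s i' j' s1 s2 s3 s4 s5 hj] at hx
          exact absurd hx (hinj₂ _ _ _ _ (hΦ₂ _).1.1 (hΦ₂ _).1.2 h1 h2 h3 h4 h5)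
        · obtain ⟨k, rfl⟩ : ∃ k, j' = k + p := ⟨j' - p, by omega⟩
          rw [hBn p s i' k s1 s2 s3 s4 (by omega)] at hx
          obtain ⟨rfl, rfl, rfl⟩ :=
            hinj₃ _ _ _ _ _ _ s1 s2 s3 s4 (by omega) h1 h2 h3 h4 h5 hx
          rfl
    · rintro rfl
      exact hBn p r i j h1 h2 h3 h4 h5
  · intro r h1 h2
    ext x
    simp only [Set.mem_preimage, Set.mem_singleton_iff, Set.mem_union, Set.mem_iUnion,
      Set.mem_ofPred_eq, Set.mem_Icc, exists_prop]
    constructor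
    · intro hx
      rcases hsurj x with ⟨s, s1, s2, rfl⟩ | ⟨s, i', j', s1, s2, s3, s4, s5, rfl⟩
      · left
        rw [← hself s s1 s2, hCn, ← hself r h1 h2, hCeq, heq] at hx
        rw [← hself s s1 s2, hCeq, heq]
        convert hx using 1
        push_cast
        ring
      · by_cases hj : j' ≤ p
        · right
          refine ⟨j', ⟨s5, hj⟩, s, ⟨s1, s2, ?_⟩, i', ⟨s3, s4⟩, rfl⟩
          rw [hBC p s i' j' s1 s2 s3 s4 s5 hj, ← hself r h1 h2, hCeq, heq] at hx
          symm
          rw [heq]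
          convert hx using 1
          push_cast
          ring
        · obtain ⟨k, rfl⟩ : ∃ k, j' = k + p := ⟨j' - p, by omega⟩
          rw [hBn p s i' k s1 s2 s3 s4 (by omega)] at hx
          exact absurd hx.symm (hinj₂ _ _ _ _ h1 h2 s1 s2 s3 s4 (by omega))
    · rintro (rfl | ⟨j, ⟨j1, j2⟩, s, ⟨s1, s2, hs⟩, i, ⟨i1, i2⟩, rfl⟩)
      · rw [hCn]
        conv_rhs => rw [← hself r h1 h2]
        congr 2
        push_cast
        ring
      · rw [hBC p s i j s1 s2 i1 i2 j1 j2]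
        conv_rhs => rw [← hself r h1 h2]
        rw [hCeq, heq]
        have := (heq _ _).1 hs.symm
        convert this using 1
        push_cast
        ring
end
end
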